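/- Let λ be a regular cardinal, and let K, L and M be λ-accessible categories which admit κ-filtered colimits for some regular cardinal κ < λ. Let F: K → L and G: M → L be functors which preserve κ-filtered colimits and λ-presentable objects. Then the pseudopullback P of F and G (the category whose objects are triples (k, m, φ) with k in K, m in M and φ: F(k) ≅ G(m) an isomorphism in L) is λ-accessible and has κ-filtered colimits. -/

import Mathlib

open CategoryTheory CategoryTheory.Limits

universe w v u

namespace PaperAcc

/-- A category `J` is `κ`-filtered if every diagram indexed by a category with fewer than `κ`
arrows admits a cocone. -/
def IsCardinalFiltered (J : Type v) [Category.{v} J] (κ : Cardinal.{v}) : Prop :=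
  ∀ (A : Type v) [SmallCategory A], Cardinal.mk (Arrow A) < κ →
    ∀ F : A ⥤ J, Nonempty (Cocone F)

/-- A preorder `P` is `κ`-directed if every subset of cardinality `< κ` has an upper bound. -/
def IsCardinalDirected (P : Type v) [Preorder P] (κ : Cardinal.{v}) : Prop :=
  ∀ S : Set P, Cardinal.mk S < κ → ∃ p : P, ∀ s ∈ S, s ≤ p

/-- An object `X` is `κ`-presentable if `Hom(X, -)` preserves `κ`-filtered colimits. -/
def IsPresentable {M : Type u} [Category.{v} M] (κ : Cardinal.{v}) (X : M) : Prop :=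
  ∀ (J : Type v) [SmallCategory J], IsCardinalFiltered J κ →
    Nonempty (PreservesColimitsOfShape J (coyoneda.obj (Opposite.op X)))

/-- A presentation of `X` as a `κ`-filtered colimit of objects belonging to `P`. -/
structure FilteredColimitPresentation {M : Type u} [Category.{v} M] (κ : Cardinal.{v})
    (P : Set M) (X : M) where
  J : Type v
  [instJ : SmallCategory J]
  filtered : IsCardinalFiltered J κ
  F : J ⥤ M
  mem : ∀ j, F.obj j ∈ P
  c : Cocone F
  isColimit : IsColimit c
  iso : c.pt ≅ X

/-- A presentation of `X` as a `κ`-directed colimit of objects belonging to `P`. -/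
structure DirectedColimitPresentation {M : Type u} [Category.{v} M] (κ : Cardinal.{v})
    (P : Set M) (X : M) where
  J : Type v
  [instJ : Preorder J]
  directed : IsCardinalDirected J κ
  F : J ⥤ M
  mem : ∀ j, F.obj j ∈ P
  c : Cocone F
  isColimit : IsColimit c
  iso : c.pt ≅ X

/-- A class of arrows (viewed as a full subcategory of the arrow category) is closed under
`κ`-filtered colimits. -/
def ClosedUnderFilteredColimits {M : Type u} [Category.{v} M] (κ : Cardinal.{v})
    (P : Set (Arrow M)) : Prop :=
  ∀ (J : Type v) [SmallCategory J], IsCardinalFiltered J κ →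
    ∀ (F : J ⥤ Arrow M) (c : Cocone F), IsColimit c → (∀ j, F.obj j ∈ P) → c.pt ∈ P

/-- The morphisms having the right lifting property with respect to every member of the
family `f`. -/
def RlpOf {M : Type u} [Category.{v} M] {ι : Type w} {A B : ι → M}
    (f : ∀ i, A i ⟶ B i) : MorphismProperty M :=
  fun _ _ g => ∀ i, HasLiftingProperty (f i) g

/-- The morphisms having the left lifting property with respect to every morphism in `P`. -/
def Llp {M : Type u} [Category.{v} M] (P : MorphismProperty M) : MorphismProperty M :=
  fun _ _ g => ∀ ⦃X Y : M⦄ (p : X ⟶ Y), P p → HasLiftingProperty g p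

/-- The class `C` is cofibrantly generated by a set of morphisms between `κ`-presentable
objects: `C = llp(rlp(I))` for such a set `I`. -/
def CofibrantlyGeneratedByPresentables {M : Type u} [Category.{v} M] (κ : Cardinal.{v})
    (C : MorphismProperty M) : Prop :=
  ∃ (ι : Type v) (A B : ι → M) (f : ∀ i, A i ⟶ B i),
    (∀ i, IsPresentable κ (A i)) ∧ (∀ i, IsPresentable κ (B i)) ∧
      C = Llp (RlpOf f)

/-- A category is locally `κ`-presentable: it is cocomplete and has a set of `κ`-presentable
objects such that every object is a `κ`-filtered colimit of objects from this set. -/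
def IsLocallyPresentable (M : Type u) [Category.{v} M] (κ : Cardinal.{v}) : Prop :=
  HasColimits M ∧
    ∃ (ι : Type v) (G : ι → M), (∀ i, IsPresentable κ (G i)) ∧
      ∀ X : M, Nonempty (FilteredColimitPresentation κ (Set.range G) X)

/-- A class of morphisms is stable under retracts (in the arrow category). -/
def IsStableUnderRetracts {M : Type u} [Category.{v} M] (P : MorphismProperty M) : Prop :=
  ∀ {X Y X' Y' : M} (f : X ⟶ Y) (g : X' ⟶ Y') (iX : X ⟶ X') (rX : X' ⟶ X)
    (iY : Y ⟶ Y') (rY : Y' ⟶ Y), iX ≫ rX = 𝟙 X → iY ≫ rY = 𝟙 Y →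
    iX ≫ g = f ≫ iY → rX ≫ f = g ≫ rY → P g → P f

/-- A model structure on a category: classes of weak equivalences, cofibrations and fibrations
satisfying the axioms of a (closed) model category. -/
structure ModelStructure (M : Type u) [Category.{v} M] where
  W : MorphismProperty M
  Cof : MorphismProperty M
  Fib : MorphismProperty M
  W_id : ∀ X : M, W (𝟙 X)
  W_comp : ∀ {X Y Z : M} (f : X ⟶ Y) (g : Y ⟶ Z), W f → W g → W (f ≫ g)
  W_of_comp_right : ∀ {X Y Z : M} (f : X ⟶ Y) (g : Y ⟶ Z), W g → W (f ≫ g) → W f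
  W_of_comp_left : ∀ {X Y Z : M} (f : X ⟶ Y) (g : Y ⟶ Z), W f → W (f ≫ g) → W g
  W_retract : IsStableUnderRetracts W
  Cof_retract : IsStableUnderRetracts Cof
  Fib_retract : IsStableUnderRetracts Fib
  lift_trivCof_fib : ∀ {A B X Y : M} (i : A ⟶ B) (p : X ⟶ Y),
    Cof i → W i → Fib p → HasLiftingProperty i p
  lift_cof_trivFib : ∀ {A B X Y : M} (i : A ⟶ B) (p : X ⟶ Y),
    Cof i → Fib p → W p → HasLiftingProperty i p
  fact_cof_trivFib : ∀ {X Y : M} (f : X ⟶ Y),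
    ∃ (Z : M) (i : X ⟶ Z) (p : Z ⟶ Y), Cof i ∧ Fib p ∧ W p ∧ i ≫ p = f
  fact_trivCof_fib : ∀ {X Y : M} (f : X ⟶ Y),
    ∃ (Z : M) (i : X ⟶ Z) (p : Z ⟶ Y), Cof i ∧ W i ∧ Fib p ∧ i ≫ p = f

/-- A model structure is `κ`-combinatorial if the underlying category is locally
`κ`-presentable and both cofibrations and trivial cofibrations are cofibrantly generated
by sets of morphisms between `κ`-presentable objects. -/
structure IsCombinatorial {M : Type u} [Category.{v} M] (S : ModelStructure M)
    (κ : Cardinal.{v}) : Prop where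
  isRegular : κ.IsRegular
  locallyPresentable : IsLocallyPresentable M κ
  cofGenerated : CofibrantlyGeneratedByPresentables κ S.Cof
  trivCofGenerated : CofibrantlyGeneratedByPresentables κ (S.Cof ⊓ S.W)

/-- An object is cofibrant if the morphism from an(y) initial object to it is a cofibration. -/
def Cofibrant {M : Type u} [Category.{v} M] (S : ModelStructure M) (X : M) : Prop :=
  ∀ ⦃O : M⦄, IsInitial O → ∀ f : O ⟶ X, S.Cof f

/-- A cylinder object for `X`: a factorization `X ⊔ X → C → X` of the codiagonal into
a cofibration followed by a weak equivalence. -/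
structure CylinderObject {M : Type u} [Category.{v} M] (S : ModelStructure M) (X : M) where
  C : M
  i₀ : X ⟶ C
  i₁ : X ⟶ C
  p : C ⟶ X
  hi₀ : i₀ ≫ p = 𝟙 X
  hi₁ : i₁ ≫ p = 𝟙 X
  hp : S.W p
  hcof : ∀ (c : BinaryCofan X X) (hc : IsColimit c), S.Cof (hc.desc (BinaryCofan.mk i₀ i₁))

/-- A commutative square on `(f, g, h, k)` (with `f : A ⟶ B`, `g : A ⟶ X`, `h : B ⟶ Y`,
`k : X ⟶ Y`) is a homotopy pushout: for some (equivalently, any) replacement of the span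
`B ← A → X` by a span of cofibrations between cofibrant objects which is weakly equivalent
to it, the comparison morphism from the (strict) pushout of the replacement to `Y` is a
weak equivalence. -/
def IsHomotopyPushout {M : Type u} [Category.{v} M] (S : ModelStructure M)
    {A B X Y : M} (f : A ⟶ B) (g : A ⟶ X) (h : B ⟶ Y) (k : X ⟶ Y) : Prop :=
  ∃ (A' B' X' P : M) (wA : A' ⟶ A) (i : A' ⟶ B') (wB : B' ⟶ B)
    (j : A' ⟶ X') (wX : X' ⟶ X) (pB : B' ⟶ P) (pX : X' ⟶ P) (m : P ⟶ Y),
      Cofibrant S A' ∧ S.W wA ∧ S.Cof i ∧ S.W wB ∧ S.Cof j ∧ S.W wX ∧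
      i ≫ wB = wA ≫ f ∧ j ≫ wX = wA ≫ g ∧
      IsPushout i j pB pX ∧ pB ≫ m = wB ≫ h ∧ pX ≫ m = wX ≫ k ∧ S.W m

/-- A morphism `i : A ⟶ B` is a formal cofibration if every pushout square of `i` along a
morphism `f : A ⟶ X` with `X` cofibrant is a homotopy pushout. -/
def IsFormalCofibration {M : Type u} [Category.{v} M] (S : ModelStructure M)
    {A B : M} (i : A ⟶ B) : Prop :=
  ∀ {X Y : M} (f : A ⟶ X) (g : B ⟶ Y) (k : X ⟶ Y),
    Cofibrant S X → IsPushout i f g k → IsHomotopyPushout S i f g k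

/-- The set of arrows satisfying `P` whose domain and codomain are `κ`-presentable. -/
def PresentableArrowsIn {M : Type u} [Category.{v} M] (κ : Cardinal.{v})
    (P : Set (Arrow M)) : Set (Arrow M) :=
  {a | a ∈ P ∧ IsPresentable κ a.left ∧ IsPresentable κ a.right}

end PaperAcc

namespace PaperAcc

/-- A category is `κ`-accessible: it has `κ`-filtered colimits and a set of `κ`-presentable
objects such that every object is a `κ`-filtered colimit of objects from this set. -/
def IsAccessibleCategory (C : Type w) [Category.{v} C] (κ : Cardinal.{v}) : Prop :=
  (∀ (J : Type v) [SmallCategory J], IsCardinalFiltered J κ → HasColimitsOfShape J C) ∧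
  ∃ (ι : Type v) (G : ι → C), (∀ i, IsPresentable κ (G i)) ∧
    ∀ X : C, Nonempty (FilteredColimitPresentation κ (Set.range G) X)

/-- The pseudopullback of `F : K ⥤ L` and `G : N ⥤ L`: objects are triples `(k, m, φ)` with
`φ : F.obj k ≅ G.obj m` an isomorphism in `L`. -/
structure Pseudopullback {K : Type u} [Category.{v} K] {L : Type u} [Category.{v} L]
    {N : Type u} [Category.{v} N] (F : K ⥤ L) (G : N ⥤ L) where
  k : K
  m : N
  φ : F.obj k ≅ G.obj m

instance {K : Type u} [Category.{v} K] {L : Type u} [Category.{v} L]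
    {N : Type u} [Category.{v} N] (F : K ⥤ L) (G : N ⥤ L) :
    Category.{v} (Pseudopullback F G) where
  Hom A B := {p : (A.k ⟶ B.k) × (A.m ⟶ B.m) //
    F.map p.1 ≫ B.φ.hom = A.φ.hom ≫ G.map p.2}
  id A := ⟨(𝟙 A.k, 𝟙 A.m), by simp⟩
  comp {A B C} p q := ⟨(p.1.1 ≫ q.1.1, p.1.2 ≫ q.1.2), by
    simp only [Functor.map_comp, Category.assoc, q.2]
    rw [← Category.assoc, p.2, Category.assoc]⟩
  id_comp p := Subtype.ext (by simp)
  comp_id p := Subtype.ext (by simp)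
  assoc p q r := Subtype.ext (by simp)

end PaperAcc

namespace CategoryTheory

section Chains

variable {O I : Type v} [LinearOrder O] [PartialOrder I]
  {C : Type u} [Category.{v} C] {D : Type u} [Category.{v} D]

/-- The element `x` lies below some member of the chain `p`. -/
def IsBelowChain (p : O ⥤ I) (x : I) : Prop := ∃ b, x ≤ p.obj b

lemma isBelowChain_obj (p : O ⥤ I) (a : O) : IsBelowChain p (p.obj a) := ⟨a, le_rfl⟩

lemma IsBelowChain.of_le {p : O ⥤ I} {x y : I} (hy : IsBelowChain p y) (h : x ≤ y) :
    IsBelowChain p x :=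
  ⟨hy.choose, h.trans hy.choose_spec⟩

/-- The map from the value of `A` at an element below the chain `p` to the point of a cocone
over the restriction of `A` to `p`. -/
noncomputable def chainGerm {A : I ⥤ C} {p : O ⥤ I} (c : Cocone (p ⋙ A)) (x : I)
    (hx : IsBelowChain p x) : A.obj x ⟶ c.pt :=
  A.map (homOfLE hx.choose_spec) ≫ c.ι.app hx.choose

lemma chainGerm_eq {A : I ⥤ C} {p : O ⥤ I} (c : Cocone (p ⋙ A)) {x : I}
    (hx : IsBelowChain p x) {b : O} (hb : x ≤ p.obj b) :
    chainGerm c x hx = A.map (homOfLE hb) ≫ c.ι.app b := by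
  have key : ∀ {b b' : O} (hb : x ≤ p.obj b) (hb' : x ≤ p.obj b'), b ≤ b' →
      A.map (homOfLE hb) ≫ c.ι.app b = A.map (homOfLE hb') ≫ c.ι.app b' := by
    intro b b' hb hb' h
    rw [← c.w (homOfLE h), Functor.comp_map, ← Category.assoc, ← A.map_comp]
    rfl
  rcases le_total hx.choose b with h | h
  · exact key _ _ h
  · exact (key _ _ h).symm

lemma chainGerm_obj {A : I ⥤ C} {p : O ⥤ I} (c : Cocone (p ⋙ A)) (a : O) :
    chainGerm c (p.obj a) (isBelowChain_obj p a) = c.ι.app a := by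
  rw [chainGerm_eq c _ le_rfl]
  simp

lemma map_chainGerm {A : I ⥤ C} {p : O ⥤ I} (c : Cocone (p ⋙ A)) {x y : I}
    (hy : IsBelowChain p y) (h : x ≤ y) :
    A.map (homOfLE h) ≫ chainGerm c y hy = chainGerm c x (hy.of_le h) := by
  rw [chainGerm_eq c hy hy.choose_spec, chainGerm_eq c _ (h.trans hy.choose_spec),
    ← Category.assoc, ← A.map_comp]
  rfl

lemma chainGerm_mapCocone {A : I ⥤ C} {p : O ⥤ I} (c : Cocone (p ⋙ A)) (F : C ⥤ D) (x : I)
    (hx : IsBelowChain p x) :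
    chainGerm (A := A ⋙ F) (p := p) (F.mapCocone c) x hx = F.map (chainGerm c x hx) := by
  rw [chainGerm_eq (A := A ⋙ F) (p := p) (F.mapCocone c) hx hx.choose_spec,
    chainGerm_eq c hx hx.choose_spec, F.map_comp]
  rfl

lemma chainGerm_hom_ext {A : I ⥤ C} {p : O ⥤ I} {c : Cocone (p ⋙ A)} (hc : IsColimit c)
    {Y : C} {u v : c.pt ⟶ Y}
    (h : ∀ a, chainGerm c (p.obj a) (isBelowChain_obj p a) ≫ u =
      chainGerm c (p.obj a) (isBelowChain_obj p a) ≫ v) : u = v :=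
  hc.hom_ext fun a ↦ by simpa only [chainGerm_obj] using h a

/-- The map between colimits along chains induced by a domination relation. -/
noncomputable def chainMap {A : I ⥤ C} {p q : O ⥤ I} {c : Cocone (p ⋙ A)} (hc : IsColimit c)
    (d : Cocone (q ⋙ A)) (h : ∀ a, IsBelowChain q (p.obj a)) : c.pt ⟶ d.pt :=
  hc.desc { pt := d.pt
            ι := { app := fun a ↦ chainGerm d (p.obj a) (h a)
                   naturality := fun a b f ↦ by
                     have := map_chainGerm d (h b) (leOfHom (p.map f))
                     exact this.trans (Category.comp_id _).symm } }

lemma chainGerm_chainMap {A : I ⥤ C} {p q : O ⥤ I} {c : Cocone (p ⋙ A)} (hc : IsColimit c)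
    (d : Cocone (q ⋙ A)) (h : ∀ a, IsBelowChain q (p.obj a)) (x : I)
    (hx : IsBelowChain p x) (hx' : IsBelowChain q x) :
    chainGerm c x hx ≫ chainMap hc d h = chainGerm d x hx' := by
  rw [chainGerm_eq c hx hx.choose_spec, Category.assoc, chainMap, hc.fac]
  exact map_chainGerm d _ _

/-- The map from the colimit along a chain to the colimit of the whole diagram. -/
noncomputable def chainDesc {A : I ⥤ C} {p : O ⥤ I} {c : Cocone (p ⋙ A)} (hc : IsColimit c)
    (d : Cocone A) : c.pt ⟶ d.pt :=
  hc.desc (d.whisker p)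

lemma chainGerm_chainDesc {A : I ⥤ C} {p : O ⥤ I} {c : Cocone (p ⋙ A)} (hc : IsColimit c)
    (d : Cocone A) (x : I) (hx : IsBelowChain p x) :
    chainGerm c x hx ≫ chainDesc hc d = d.ι.app x := by
  rw [chainGerm_eq c hx hx.choose_spec, Category.assoc, chainDesc, hc.fac]
  exact d.w _

lemma map_chainMap {A : I ⥤ C} {p q : O ⥤ I} {c : Cocone (p ⋙ A)} (hc : IsColimit c)
    (d : Cocone (q ⋙ A)) (h : ∀ a, IsBelowChain q (p.obj a)) (F : C ⥤ D)
    (hc' : IsColimit (F.mapCocone c)) :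
    F.map (chainMap hc d h) =
      chainMap (A := A ⋙ F) (p := p) (q := q) hc' (F.mapCocone d) h := by
  refine chainGerm_hom_ext (A := A ⋙ F) (p := p) hc' fun a ↦ ?_
  rw [chainGerm_chainMap (A := A ⋙ F) (p := p) (q := q) hc' (F.mapCocone d) h _ _ (h a),
    chainGerm_mapCocone, chainGerm_mapCocone, ← chainGerm_chainMap hc d h _ _ (h a), F.map_comp]

lemma map_chainDesc {A : I ⥤ C} {p : O ⥤ I} {c : Cocone (p ⋙ A)} (hc : IsColimit c)
    (d : Cocone A) (F : C ⥤ D) (hc' : IsColimit (F.mapCocone c)) :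
    F.map (chainDesc hc d) = chainDesc (A := A ⋙ F) (p := p) hc' (F.mapCocone d) := by
  refine chainGerm_hom_ext (A := A ⋙ F) (p := p) hc' fun a ↦ ?_
  rw [chainGerm_chainDesc (A := A ⋙ F) (p := p) hc' (F.mapCocone d),
    chainGerm_mapCocone]
  exact (F.map_comp _ _).symm.trans (congrArg F.map (chainGerm_chainDesc hc d _ _))

/-- If the values of `Φ` on a directed preorder `T` are covered by compatible maps from the values
of a diagram `A`, and every value of `A` occurs, then `Φ` and `A` have the same colimit. -/
lemma nonempty_isColimit_of_cover {T : Type v} [Preorder T] [IsDirectedOrder T]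
    {A : I ⥤ C} {c : Cocone A} (hc : IsColimit c) {Φ : T ⥤ C} (e : Φ ⟶ (Functor.const T).obj c.pt)
    (M : T → I → Prop) (γ : ∀ t x, M t x → (A.obj x ⟶ Φ.obj t))
    (hext : ∀ (t : T) (Y : C) (u v : Φ.obj t ⟶ Y),
      (∀ x h, γ t x h ≫ u = γ t x h ≫ v) → u = v)
    (hγ : ∀ {t x y} (h : M t y) (hxy : x ≤ y), ∃ h' : M t x,
      A.map (homOfLE hxy) ≫ γ t y h = γ t x h')
    (hΦ : ∀ {s t x} (f : s ⟶ t) (h : M s x), ∃ h' : M t x, γ s x h ≫ Φ.map f = γ t x h')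
    (he : ∀ t x h, γ t x h ≫ e.app t = c.ι.app x)
    (hM : ∀ x, ∃ t, M t x) : Nonempty (IsColimit (Cocone.mk c.pt e)) := by
  have indep : ∀ (s : Cocone Φ) {x t t'} (h : M t x) (h' : M t' x),
      γ t x h ≫ s.ι.app t = γ t' x h' ≫ s.ι.app t' := by
    intro s x t t' h h'
    obtain ⟨r, hr, hr'⟩ := exists_ge_ge t t'
    obtain ⟨_, e₁⟩ := hΦ (homOfLE hr) h
    obtain ⟨_, e₂⟩ := hΦ (homOfLE hr') h'
    rw [← s.w (homOfLE hr), ← s.w (homOfLE hr'), ← Category.assoc, ← Category.assoc, e₁, e₂]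
  choose τ hτ using hM
  let K (s : Cocone Φ) : Cocone A :=
    { pt := s.pt
      ι := { app := fun x ↦ γ (τ x) x (hτ x) ≫ s.ι.app (τ x)
             naturality := fun x y f ↦ by
               obtain ⟨h', e'⟩ := hγ (hτ y) (leOfHom f)
               have := indep s h' (hτ x)
               rw [← e', Category.assoc] at this
               exact this.trans (Category.comp_id _).symm } }
  refine ⟨{ desc := fun s ↦ hc.desc (K s), fac := fun s t ↦ ?_, uniq := fun s m hm ↦ ?_ }⟩
  · refine hext _ _ _ _ fun x h ↦ ?_
    have h₁ := he t x h
    have h₂ := hc.fac (K s) x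
    dsimp at h₁ h₂ ⊢
    rw [← Category.assoc, h₁, h₂]
    exact indep s _ _
  · refine hc.hom_ext fun x ↦ ?_
    rw [hc.fac, ← he _ _ (hτ x), Category.assoc]
    exact congrArg _ (hm (τ x))

variable {T : Type v} [Preorder T] (P : T → (O ⥤ I))

/-- A family of chains is monotone if chains of larger index dominate those of smaller index. -/
def IsMonotoneFamily : Prop := ∀ ⦃s t⦄, s ≤ t → ∀ a, IsBelowChain (P t) ((P s).obj a)

variable {P} [HasColimitsOfShape O C]

lemma IsMonotoneFamily.isBelowChain (hP : IsMonotoneFamily P) {s t : T} (h : s ≤ t) {x : I}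
    (hx : IsBelowChain (P s) x) : IsBelowChain (P t) x :=
  (hP h hx.choose).of_le hx.choose_spec

/-- The diagram of colimits of `A` along a monotone family of chains. -/
@[simps]
noncomputable def chainFunctor (hP : IsMonotoneFamily P) (A : I ⥤ C) : T ⥤ C where
  obj t := colimit (P t ⋙ A)
  map f := chainMap (colimit.isColimit _) (colimit.cocone _) (hP (leOfHom f))
  map_id t := chainGerm_hom_ext (colimit.isColimit _) fun a ↦ by
    rw [chainGerm_chainMap _ _ _ _ _ (isBelowChain_obj _ a)]
    exact (Category.comp_id _).symm
  map_comp {r s t} f g := chainGerm_hom_ext (colimit.isColimit _) fun a ↦ by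
    rw [chainGerm_chainMap _ _ _ _ _ (hP (leOfHom (f ≫ g)) a), ← Category.assoc,
      chainGerm_chainMap _ _ _ _ _ (hP (leOfHom f) a),
      chainGerm_chainMap _ _ _ _ _ (hP (leOfHom (f ≫ g)) a)]

/-- The cocone over the diagram of colimits of `A` along chains induced by a cocone over `A`. -/
@[simps]
noncomputable def chainFunctorCocone (hP : IsMonotoneFamily P) {A : I ⥤ C} (c : Cocone A) :
    Cocone (chainFunctor hP A) where
  pt := c.pt
  ι :=
    { app := fun t ↦ chainDesc (colimit.isColimit _) c
      naturality := fun s t f ↦ chainGerm_hom_ext (colimit.isColimit _) fun a ↦ by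
        have h₁ := chainGerm_chainMap (colimit.isColimit (P s ⋙ A)) (colimit.cocone (P t ⋙ A))
          (hP (leOfHom f)) _ (isBelowChain_obj _ a) (hP (leOfHom f) a)
        have h₂ := congrArg (· ≫ chainDesc (colimit.isColimit (P t ⋙ A)) c) h₁
        simp only [Category.assoc, chainGerm_chainDesc] at h₂
        exact h₂.trans ((chainGerm_chainDesc (colimit.isColimit (P s ⋙ A)) c _ _).symm.trans
          (congrArg _ (Category.comp_id _).symm)) }

/-- If a directed monotone family of chains covers the index poset of `A`, then the diagram of
colimits of `A` along these chains has the same colimit as `A`. -/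
lemma nonempty_isColimit_chainFunctorCocone [IsDirectedOrder T] (hP : IsMonotoneFamily P)
    {A : I ⥤ C} {c : Cocone A} (hc : IsColimit c) (h : ∀ x, ∃ t, IsBelowChain (P t) x) :
    Nonempty (IsColimit (chainFunctorCocone hP c)) :=
  nonempty_isColimit_of_cover hc (chainFunctorCocone hP c).ι (fun t x ↦ IsBelowChain (P t) x)
    (fun _ x h ↦ chainGerm (colimit.cocone _) x h)
    (fun _ _ _ _ h ↦ chainGerm_hom_ext (colimit.isColimit _) fun _ ↦ h _ _)
    (fun h hxy ↦ ⟨h.of_le hxy, map_chainGerm _ h hxy⟩)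
    (fun f h ↦ ⟨hP.isBelowChain (leOfHom f) h, chainGerm_chainMap _ _ _ _ _ _⟩)
    (fun _ _ _ ↦ chainGerm_chainDesc _ _ _ _) h

end Chains

section Interleaving

variable {O I : Type v} [LinearOrder O] [PartialOrder I] {L : Type u} [Category.{v} L]

/-- Two diagrams `A` and `B` on a poset which are interleaved: every value of `A` maps to a later
value of `B` and conversely, and these maps become natural and mutually inverse at stages beyond
those prescribed by `bound`. -/
structure Interleaving (A B : I ⥤ L) where
  next : I → I
  bound : I → I → I
  f : ∀ x, A.obj x ⟶ B.obj (next x)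
  g : ∀ x, B.obj x ⟶ A.obj (next x)
  le_next : ∀ x, x ≤ next x
  next_left_le : ∀ x y, next x ≤ bound x y
  next_right_le : ∀ x y, next y ≤ bound x y
  f_natural : ∀ {x y z} (h : x ≤ y) (_ : bound x y ≤ z) (hx : next x ≤ z) (hy : next y ≤ z),
    f x ≫ B.map (homOfLE hx) = A.map (homOfLE h) ≫ f y ≫ B.map (homOfLE hy)
  g_natural : ∀ {x y z} (h : x ≤ y) (_ : bound x y ≤ z) (hx : next x ≤ z) (hy : next y ≤ z),
    g x ≫ A.map (homOfLE hx) = B.map (homOfLE h) ≫ g y ≫ A.map (homOfLE hy)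
  f_g : ∀ {x y z} (h : next x ≤ y) (_ : bound x y ≤ z) (hy : next y ≤ z) (hx : x ≤ z),
    f x ≫ B.map (homOfLE h) ≫ g y ≫ A.map (homOfLE hy) = A.map (homOfLE hx)
  g_f : ∀ {x y z} (h : next x ≤ y) (_ : bound x y ≤ z) (hy : next y ≤ z) (hx : x ≤ z),
    g x ≫ A.map (homOfLE h) ≫ f y ≫ B.map (homOfLE hy) = B.map (homOfLE hx)

namespace Interleaving

variable {A B : I ⥤ L}

/-- The interleaving with the roles of the two diagrams exchanged. -/
@[simps]
def symm (D : Interleaving A B) : Interleaving B A where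
  next := D.next
  bound := D.bound
  f := D.g
  g := D.f
  le_next := D.le_next
  next_left_le := D.next_left_le
  next_right_le := D.next_right_le
  f_natural := D.g_natural
  g_natural := D.f_natural
  f_g := D.g_f
  g_f := D.f_g

variable (D : Interleaving A B)

/-- A chain is adapted to an interleaving if it climbs past all the prescribed bounds. -/
def IsAdapted (p : O ⥤ I) : Prop :=
  ∀ a b c, a ≤ b → b < c → D.bound (p.obj a) (p.obj b) ≤ p.obj c

/-- The map `D.f` at `x` agrees with the one at `y ≥ x` at the stage `z`. -/
def Agrees (x y z : I) : Prop :=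
  ∃ (h : x ≤ y) (hx : D.next x ≤ z) (hy : D.next y ≤ z),
    D.f x ≫ B.map (homOfLE hx) = A.map (homOfLE h) ≫ D.f y ≫ B.map (homOfLE hy)

variable {D}

lemma agrees_of_bound_le {x y z : I} (h : x ≤ y) (hz : D.bound x y ≤ z) : D.Agrees x y z :=
  ⟨h, (D.next_left_le _ _).trans hz, (D.next_right_le _ _).trans hz, D.f_natural h hz _ _⟩

lemma Agrees.mono {x y z z' : I} (h : D.Agrees x y z) (hz : z ≤ z') : D.Agrees x y z' := by
  obtain ⟨h, hx, hy, e⟩ := h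
  refine ⟨h, hx.trans hz, hy.trans hz, ?_⟩
  have := congrArg (· ≫ B.map (homOfLE hz)) e
  simpa only [Category.assoc, ← B.map_comp, homOfLE_comp] using this

lemma Agrees.trans {w x y z : I} (h₁ : D.Agrees w x z) (h₂ : D.Agrees x y z) :
    D.Agrees w y z := by
  obtain ⟨h, hx, hy, e⟩ := h₁
  obtain ⟨h', hx', hy', e'⟩ := h₂
  refine ⟨h.trans h', hx, hy', ?_⟩
  rw [e, e', ← Category.assoc, ← A.map_comp, homOfLE_comp]

variable {p : O ⥤ I}

lemma IsAdapted.next_le (hp : D.IsAdapted p) {a c : O} (h : a < c) :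
    D.next (p.obj a) ≤ p.obj c :=
  (D.next_left_le _ _).trans (hp a a c le_rfl h)

lemma Agrees.map_comp_chainGerm (d : Cocone (p ⋙ B)) {x y : I} {c : O}
    (h : D.Agrees x y (p.obj c)) (hx : IsBelowChain p (D.next x))
    (hy : IsBelowChain p (D.next y)) (hxy : x ≤ y) :
    A.map (homOfLE hxy) ≫ D.f y ≫ chainGerm d _ hy = D.f x ≫ chainGerm d _ hx := by
  obtain ⟨_, hx', hy', e⟩ := h
  rw [chainGerm_eq d hy hy', chainGerm_eq d hx hx', ← Category.assoc (D.f x), e]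
  simp only [Category.assoc]

variable [NoMaxOrder O]

lemma IsAdapted.isBelowChain_next (hp : D.IsAdapted p) (a : O) :
    IsBelowChain p (D.next (p.obj a)) := by
  obtain ⟨c, hc⟩ := exists_gt a
  exact ⟨c, hp.next_le hc⟩

lemma IsAdapted.exists_agrees (hp : D.IsAdapted p) {a b : O} (h : a ≤ b) :
    ∃ c, D.Agrees (p.obj a) (p.obj b) (p.obj c) := by
  obtain ⟨c, hc⟩ := exists_gt b
  exact ⟨c, agrees_of_bound_le (leOfHom (p.map (homOfLE h))) (hp a b c h hc)⟩

/-- The comparison map between the colimits of two interleaved diagrams along an adapted chain. -/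
noncomputable def chainHom (hp : D.IsAdapted p) {c : Cocone (p ⋙ A)} (hc : IsColimit c)
    (d : Cocone (p ⋙ B)) : c.pt ⟶ d.pt :=
  hc.desc { pt := d.pt
            ι := { app := fun a ↦ D.f (p.obj a) ≫ chainGerm d _ (hp.isBelowChain_next a)
                   naturality := fun a b f ↦ by
                     obtain ⟨c, hc⟩ := hp.exists_agrees (leOfHom f)
                     exact (hc.map_comp_chainGerm d (hp.isBelowChain_next a)
                       (hp.isBelowChain_next b) (leOfHom (p.map f))).trans
                       (Category.comp_id _).symm } }

lemma Agrees.chainGerm_chainHom (hp : D.IsAdapted p) {c : Cocone (p ⋙ A)} (hc : IsColimit c)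
    (d : Cocone (p ⋙ B)) {x : I} {a b : O} (h : D.Agrees x (p.obj a) (p.obj b))
    (hx : IsBelowChain p x) (hx' : IsBelowChain p (D.next x)) :
    chainGerm c x hx ≫ chainHom hp hc d = D.f x ≫ chainGerm d _ hx' := by
  rw [chainGerm_eq c hx h.choose, Category.assoc, chainHom, hc.fac]
  exact h.map_comp_chainGerm d hx' _ _

lemma ι_chainHom (hp : D.IsAdapted p) {c : Cocone (p ⋙ A)} (hc : IsColimit c)
    (d : Cocone (p ⋙ B)) (a : O) :
    c.ι.app a ≫ chainHom hp hc d =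
      D.f (p.obj a) ≫ chainGerm d _ (hp.isBelowChain_next a) :=
  hc.fac _ a

lemma chainHom_comp_chainHom_symm (hp : D.IsAdapted p) (hp' : D.symm.IsAdapted p)
    {c : Cocone (p ⋙ A)} (hc : IsColimit c) {d : Cocone (p ⋙ B)} (hd : IsColimit d) :
    chainHom hp hc d ≫ chainHom hp' hd c = 𝟙 _ := by
  refine hc.hom_ext fun a ↦ ?_
  obtain ⟨b, hb⟩ := exists_gt a
  obtain ⟨e, he⟩ := exists_gt b
  rw [← Category.assoc, ι_chainHom, chainGerm_eq d _ (hp.next_le hb), Category.assoc,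
    Category.assoc, ι_chainHom hp' hd c, chainGerm_eq c _ (hp'.next_le he), Category.comp_id]
  have := D.f_g (hp.next_le hb) (hp a b e hb.le he) (hp.next_le he)
    (leOfHom (p.map (homOfLE (hb.trans he).le)))
  simp only [symm_f]
  have h₂ := congrArg (· ≫ c.ι.app e) this
  simp only [Category.assoc] at h₂
  exact h₂.trans (c.w (homOfLE (hb.trans he).le))

lemma chainMap_comp_chainHom {q : O ⥤ I} (hp : D.IsAdapted p) (hq : D.IsAdapted q)
    {c : Cocone (p ⋙ A)} (hc : IsColimit c) {c' : Cocone (q ⋙ A)} (hc' : IsColimit c')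
    {d : Cocone (p ⋙ B)} (hd : IsColimit d) (d' : Cocone (q ⋙ B))
    (h : ∀ a, ∃ b c, D.Agrees (p.obj a) (q.obj b) (q.obj c))
    (h' : ∀ a, IsBelowChain q (p.obj a)) :
    chainMap hc c' h' ≫ chainHom hq hc' d' = chainHom hp hc d ≫ chainMap hd d' h' := by
  refine chainGerm_hom_ext hc fun a ↦ ?_
  obtain ⟨b, e, hb⟩ := h a
  have hx : IsBelowChain q (D.next (p.obj a)) := ⟨e, hb.choose_spec.choose⟩
  rw [← Category.assoc, chainGerm_chainMap _ _ _ _ _ (h' a), hb.chainGerm_chainHom hq hc' d' _ hx,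
    ← Category.assoc, chainGerm_obj, ι_chainHom, Category.assoc,
    chainGerm_chainMap _ _ _ _ _ hx]

lemma chainDesc_comp (hp : D.IsAdapted p) {c : Cocone (p ⋙ A)} (hc : IsColimit c)
    {d : Cocone (p ⋙ B)} (hd : IsColimit d) (a : Cocone A) (b : Cocone B) (φ : a.pt ⟶ b.pt)
    (h : ∀ x, D.f x ≫ b.ι.app (D.next x) = a.ι.app x ≫ φ) :
    chainDesc hc a ≫ φ = chainHom hp hc d ≫ chainDesc hd b := by
  refine chainGerm_hom_ext hc fun i ↦ ?_
  rw [← Category.assoc, chainGerm_chainDesc, ← Category.assoc, chainGerm_obj, ι_chainHom,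
    Category.assoc, chainGerm_chainDesc, h]

/-- Two interleaved diagrams have isomorphic colimits along an adapted chain. -/
@[simps]
noncomputable def chainIso (hp : D.IsAdapted p) {c : Cocone (p ⋙ A)} (hc : IsColimit c)
    {d : Cocone (p ⋙ B)} (hd : IsColimit d) : c.pt ≅ d.pt where
  hom := chainHom hp hc d
  inv := chainHom (D := D.symm) hp hd c
  hom_inv_id := chainHom_comp_chainHom_symm hp hp hc hd
  inv_hom_id := chainHom_comp_chainHom_symm (D := D.symm) hp hp hd hc

/-- The adapted chains, preordered by compatible domination. -/
def AdaptedChain (O : Type v) [LinearOrder O] (D : Interleaving A B) : Type v :=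
  { p : O ⥤ I // D.IsAdapted p }

instance : Preorder (AdaptedChain O D) where
  le p q := ∀ a, ∃ b c, D.Agrees (p.1.obj a) (q.1.obj b) (q.1.obj c)
  le_refl p a := ⟨a, p.2.exists_agrees le_rfl⟩
  le_trans p q r hpq hqr a := by
    obtain ⟨b, c, h⟩ := hpq a
    obtain ⟨b', c', h'⟩ := hqr b
    obtain ⟨e, _, h''⟩ := hqr c
    refine ⟨b', max e c', ?_⟩
    have h₁ : q.1.obj c ≤ r.1.obj (max e c') :=
      h''.choose.trans (leOfHom (r.1.map (homOfLE (le_max_left _ _))))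
    exact (h.mono h₁).trans (h'.mono (leOfHom (r.1.map (homOfLE (le_max_right _ _)))))

variable (O D) in
lemma isMonotoneFamily_adaptedChain :
    IsMonotoneFamily (fun t : AdaptedChain O D ↦ t.1) := fun _ _ h a ↦ by
  obtain ⟨b, _, hb⟩ := h a
  exact ⟨b, hb.choose⟩

end Interleaving

end Interleaving

lemma HasCardinalFilteredColimits.of_le {C : Type u} [Category.{v} C] {κ μ : Cardinal.{w}}
    [Fact κ.IsRegular] [Fact μ.IsRegular] [HasCardinalFilteredColimits C κ] (h : κ ≤ μ) :
    HasCardinalFilteredColimits C μ where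
  hasColimitsOfShape J _ _ := by
    have := IsCardinalFiltered.of_le J h
    exact HasCardinalFilteredColimits.hasColimitsOfShape (κ := κ) C J

lemma hasCardinalLT_arrow_of_preorder {O : Type v} [Preorder O] {μ : Cardinal.{v}}
    [Fact μ.IsRegular] (hO : HasCardinalLT O μ) :
    HasCardinalLT (Arrow O) μ := by
  refine (hasCardinalLT_prod (Fact.out : μ.IsRegular).aleph0_le hO hO).of_injective
    (fun f : Arrow O ↦ (f.left, f.right)) ?_
  rintro ⟨a, b, f⟩ ⟨a', b', f'⟩ h
  obtain ⟨rfl, rfl⟩ := Prod.ext_iff.1 h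
  obtain rfl := Subsingleton.elim f f'
  rfl

section Existence

variable {O I : Type v} [LinearOrder O] [PartialOrder I] {L : Type u} [Category.{v} L]
  {A B : I ⥤ L} {μ : Cardinal.{v}} [Fact μ.IsRegular]

lemma exists_forall_le_of_hasCardinalLT (I : Type v) [Preorder I] [IsCardinalFiltered I μ]
    {X : Type v} (E : X → I) (hX : HasCardinalLT X μ) : ∃ i, ∀ x, E x ≤ i :=
  ⟨IsCardinalFiltered.max E hX, fun x ↦ leOfHom (IsCardinalFiltered.toMax E hX x)⟩

namespace Interleaving

variable [WellFoundedLT O] (D : Interleaving A B)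

lemma exists_isAdapted [IsCardinalFiltered I μ] (hO : HasCardinalLT O μ)
    {X : Type v} (E : X → I) (hX : HasCardinalLT X μ) :
    ∃ p : O ⥤ I, D.IsAdapted p ∧ (∀ x a, E x ≤ p.obj a) ∧
      ∀ x a b, a < b → D.bound (E x) (p.obj a) ≤ p.obj b := by
  have hμ : Cardinal.aleph0 ≤ μ := (Fact.out : μ.IsRegular).aleph0_le
  have key (c : O) (q : Set.Iio c → I) : ∃ i, ∀ w : (X ⊕ Set.Iio c) × (X ⊕ Set.Iio c),
      D.bound (Sum.elim E q w.1) (Sum.elim E q w.2) ≤ i := by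
    refine exists_forall_le_of_hasCardinalLT (μ := μ) I _ ?_
    have : HasCardinalLT (X ⊕ Set.Iio c) μ := by
      rw [hasCardinalLT_sum_iff _ _ _ hμ]
      exact ⟨hX, hO.of_injective _ Subtype.val_injective⟩
    exact hasCardinalLT_prod hμ this this
  choose ub hub using key
  let q : O → I := WellFoundedLT.fix (motive := fun _ ↦ I) fun c ih ↦ ub c fun a ↦ ih a.1 a.2
  have hq (c : O) : q c = ub c fun a ↦ q a.1 := WellFoundedLT.fix_eq _ c
  have hb (c : O) (w : (X ⊕ Set.Iio c) × (X ⊕ Set.Iio c)) :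
      D.bound (Sum.elim E (fun a ↦ q a.1) w.1) (Sum.elim E (fun a ↦ q a.1) w.2) ≤ q c := by
    rw [hq c]
    exact hub c _ w
  have hmono : Monotone q := by
    intro a c h
    rcases h.eq_or_lt with rfl | h
    · rfl
    · exact (D.le_next _).trans
        ((D.next_left_le _ _).trans (hb c ⟨Sum.inr ⟨a, h⟩, Sum.inr ⟨a, h⟩⟩))
  refine ⟨hmono.functor, fun a b c hab hbc ↦ ?_, fun x a ↦ ?_, fun x a b h ↦ ?_⟩
  · exact hb c ⟨Sum.inr ⟨a, hab.trans_lt hbc⟩, Sum.inr ⟨b, hbc⟩⟩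
  · exact (D.le_next _).trans ((D.next_left_le _ _).trans (hb a ⟨Sum.inl x, Sum.inl x⟩))
  · exact hb b ⟨Sum.inl x, Sum.inr ⟨a, h⟩⟩

variable [Nonempty O]

lemma exists_adaptedChain_isBelowChain [IsCardinalFiltered I μ] (hO : HasCardinalLT O μ)
    (x : I) : ∃ t : AdaptedChain O D, IsBelowChain t.1 x := by
  obtain ⟨p, hp, hle, -⟩ := D.exists_isAdapted hO (fun _ : PUnit.{v + 1} ↦ x)
    (hasCardinalLT_of_finite _ _ (Fact.out : μ.IsRegular).aleph0_le)
  obtain ⟨b⟩ := ‹Nonempty O›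
  exact ⟨⟨p, hp⟩, b, hle ⟨⟩ b⟩

variable [NoMaxOrder O]

lemma isCardinalFiltered_adaptedChain [IsCardinalFiltered I μ] (hO : HasCardinalLT O μ) :
    IsCardinalFiltered (AdaptedChain O D) μ := by
  have hμ : Cardinal.aleph0 ≤ μ := (Fact.out : μ.IsRegular).aleph0_le
  refine isCardinalFiltered_preorder _ _ fun X t hX ↦ ?_
  rw [← hasCardinalLT_iff_cardinal_mk_lt] at hX
  obtain ⟨p, hp, hle, hbound⟩ := D.exists_isAdapted hO
    (fun w : X × O ↦ (t w.1).1.obj w.2) (hasCardinalLT_prod hμ hX hO)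
  refine ⟨⟨p, hp⟩, fun x a ↦ ?_⟩
  obtain ⟨b⟩ := ‹Nonempty O›
  obtain ⟨c, hc⟩ := exists_gt b
  exact ⟨b, c, agrees_of_bound_le (hle (x, a) b) (hbound (x, a) b c hc)⟩

end Interleaving

open Filter in
lemma eventually_comp_map_eq [IsCardinalFiltered I μ] {c : Cocone A} (hc : IsColimit c) {X : L}
    [IsCardinalPresentable X μ] {i j : I} (u : X ⟶ A.obj i) (v : X ⟶ A.obj j)
    (h : u ≫ c.ι.app i = v ≫ c.ι.app j) :
    ∀ᶠ z in atTop, ∀ (hi : i ≤ z) (hj : j ≤ z),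
      u ≫ A.map (homOfLE hi) = v ≫ A.map (homOfLE hj) := by
  obtain ⟨k, a, b, e⟩ := IsCardinalPresentable.exists_eq_of_isColimit μ hc u v h
  filter_upwards [eventually_ge_atTop k] with z hz hi hj
  have := congrArg (· ≫ A.map (homOfLE hz)) e
  simp only [Category.assoc, ← A.map_comp] at this
  exact this

open Filter in
/-- Diagrams of presentable objects with isomorphic colimits are interleaved. -/
lemma exists_interleaving [IsCardinalFiltered I μ] {a : Cocone A} {b : Cocone B}
    (ha : IsColimit a) (hb : IsColimit b) (φ : a.pt ≅ b.pt)
    (hA : ∀ x, IsCardinalPresentable (A.obj x) μ)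
    (hB : ∀ x, IsCardinalPresentable (B.obj x) μ) :
    ∃ D : Interleaving A B, ∀ x, D.f x ≫ b.ι.app (D.next x) = a.ι.app x ≫ φ.hom := by
  have := isFiltered_of_isCardinalFiltered I μ
  have hdir : IsDirectedOrder I := IsFiltered.isDirectedOrder I
  have hne : Nonempty I := IsFiltered.nonempty
  have h₁ (x : I) : ∃ n, ∃ (_ : x ≤ n) (f : A.obj x ⟶ B.obj n) (g : B.obj x ⟶ A.obj n),
      f ≫ b.ι.app n = a.ι.app x ≫ φ.hom ∧ g ≫ a.ι.app n = b.ι.app x ≫ φ.inv := by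
    obtain ⟨i, f, hf⟩ := IsCardinalPresentable.exists_hom_of_isColimit μ hb (a.ι.app x ≫ φ.hom)
    obtain ⟨j, g, hg⟩ := IsCardinalPresentable.exists_hom_of_isColimit μ ha (b.ι.app x ≫ φ.inv)
    obtain ⟨k, hik, hjk⟩ := exists_ge_ge i j
    obtain ⟨n, hkn, hxn⟩ := exists_ge_ge k x
    refine ⟨n, hxn, f ≫ B.map (homOfLE (hik.trans hkn)),
      g ≫ A.map (homOfLE (hjk.trans hkn)), ?_, ?_⟩
    · rw [Category.assoc, b.w, hf]
    · rw [Category.assoc, a.w, hg]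
  choose n hn f g hf hg using h₁
  have h₂ (x y : I) : ∃ r, ∀ z, r ≤ z → n x ≤ z ∧ n y ≤ z ∧
      (∀ (h : x ≤ y) (hx : n x ≤ z) (hy : n y ≤ z),
        f x ≫ B.map (homOfLE hx) = A.map (homOfLE h) ≫ f y ≫ B.map (homOfLE hy)) ∧
      (∀ (h : x ≤ y) (hx : n x ≤ z) (hy : n y ≤ z),
        g x ≫ A.map (homOfLE hx) = B.map (homOfLE h) ≫ g y ≫ A.map (homOfLE hy)) ∧
      (∀ (h : n x ≤ y) (hy : n y ≤ z) (hx : x ≤ z),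
        f x ≫ B.map (homOfLE h) ≫ g y ≫ A.map (homOfLE hy) = A.map (homOfLE hx)) ∧
      (∀ (h : n x ≤ y) (hy : n y ≤ z) (hx : x ≤ z),
        g x ≫ A.map (homOfLE h) ≫ f y ≫ B.map (homOfLE hy) = B.map (homOfLE hx)) := by
    rw [← eventually_atTop]
    refine (eventually_ge_atTop _).and ((eventually_ge_atTop _).and
      (Eventually.and ?_ (Eventually.and ?_ (Eventually.and ?_ ?_))))
    · refine eventually_all.2 fun h ↦ ?_
      refine (eventually_comp_map_eq (μ := μ) hb (f x) (A.map (homOfLE h) ≫ f y) ?_).mono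
        fun z hz hx hy ↦ by simpa only [Category.assoc] using hz hx hy
      rw [Category.assoc, hf, hf, a.w_assoc]
    · refine eventually_all.2 fun h ↦ ?_
      refine (eventually_comp_map_eq (μ := μ) ha (g x) (B.map (homOfLE h) ≫ g y) ?_).mono
        fun z hz hx hy ↦ by simpa only [Category.assoc] using hz hx hy
      rw [Category.assoc, hg, hg, b.w_assoc]
    · refine eventually_all.2 fun h ↦ ?_
      refine (eventually_comp_map_eq (μ := μ) ha (f x ≫ B.map (homOfLE h) ≫ g y) (𝟙 _) ?_).mono
        fun z hz hx hy ↦ by simpa only [Category.assoc, Category.id_comp] using hz hx hy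
      rw [Category.assoc, Category.assoc, hg, b.w_assoc, ← Category.assoc, hf]
      simp
    · refine eventually_all.2 fun h ↦ ?_
      refine (eventually_comp_map_eq (μ := μ) hb (g x ≫ A.map (homOfLE h) ≫ f y) (𝟙 _) ?_).mono
        fun z hz hx hy ↦ by simpa only [Category.assoc, Category.id_comp] using hz hx hy
      rw [Category.assoc, Category.assoc, hf, a.w_assoc, ← Category.assoc, hg]
      simp
  choose r hr using h₂
  exact ⟨{
      next := n
      bound := r
      f := f
      g := g
      le_next := hn
      next_left_le := fun x y ↦ (hr x y _ le_rfl).1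
      next_right_le := fun x y ↦ (hr x y _ le_rfl).2.1
      f_natural := fun h hz ↦ (hr _ _ _ hz).2.2.1 h
      g_natural := fun h hz ↦ (hr _ _ _ hz).2.2.2.1 h
      f_g := fun h hz ↦ (hr _ _ _ hz).2.2.2.2.1 h
      g_f := fun h hz ↦ (hr _ _ _ hz).2.2.2.2.2 h }, hf⟩

end Existence

end CategoryTheory

namespace PaperAcc

namespace Pseudopullback

variable {K : Type u} [Category.{v} K] {L : Type u} [Category.{v} L]
  {N : Type u} [Category.{v} N] {F : K ⥤ L} {G : N ⥤ L}

variable (F G) in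
/-- The projection of the pseudopullback to the first factor. -/
@[simps]
abbrev fst : Pseudopullback F G ⥤ K where
  obj X := X.k
  map f := f.1.1

variable (F G) in
/-- The projection of the pseudopullback to the second factor. -/
@[simps]
abbrev snd : Pseudopullback F G ⥤ N where
  obj X := X.m
  map f := f.1.2

variable (F G) in
/-- The tautological isomorphism between the two composites to the base. -/
def squareIso : fst F G ⋙ F ≅ snd F G ⋙ G :=
  NatIso.ofComponents (fun X ↦ X.φ) fun f ↦ f.2

/-- Constructor for morphisms in the pseudopullback. -/
abbrev homMk {X Y : Pseudopullback F G} (f : X.k ⟶ Y.k) (g : X.m ⟶ Y.m)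
    (h : F.map f ≫ Y.φ.hom = X.φ.hom ≫ G.map g) : X ⟶ Y :=
  ⟨(f, g), h⟩

@[ext]
lemma hom_ext {X Y : Pseudopullback F G} {f g : X ⟶ Y} (h₁ : (fst F G).map f = (fst F G).map g)
    (h₂ : (snd F G).map f = (snd F G).map g) : f = g :=
  Subtype.ext (Prod.ext h₁ h₂)

/-- Isomorphisms in the pseudopullback are given componentwise. -/
def isoMk {X Y : Pseudopullback F G} (e : X.k ≅ Y.k) (e' : X.m ≅ Y.m)
    (h : F.map e.hom ≫ Y.φ.hom = X.φ.hom ≫ G.map e'.hom) : X ≅ Y where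
  hom := homMk e.hom e'.hom h
  inv := homMk e.inv e'.inv (by
    rw [← cancel_epi (F.map e.hom), ← Category.assoc, ← F.map_comp, e.hom_inv_id, F.map_id,
      Category.id_comp, ← Category.assoc, h, Category.assoc, ← G.map_comp, e'.hom_inv_id,
      G.map_id, Category.comp_id])
  hom_inv_id := hom_ext e.hom_inv_id e'.hom_inv_id
  inv_hom_id := hom_ext e.inv_hom_id e'.inv_hom_id

section Colimits

variable {J : Type v} [Category.{v} J] {Y : J ⥤ Pseudopullback F G}

/-- A cocone in the pseudopullback is colimiting if its projections are and the colimit of the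
first projection is preserved. -/
def isColimitOfProjections {c : Cocone Y} (h₁ : IsColimit ((fst F G).mapCocone c))
    (h₂ : IsColimit ((snd F G).mapCocone c)) [PreservesColimit (Y ⋙ fst F G) F] :
    IsColimit c where
  desc s := homMk (h₁.desc ((fst F G).mapCocone s)) (h₂.desc ((snd F G).mapCocone s)) (by
    refine (isColimitOfPreserves F h₁).hom_ext fun j ↦ ?_
    have e₁ := h₁.fac ((fst F G).mapCocone s) j
    have e₂ := h₂.fac ((snd F G).mapCocone s) j
    have hs : F.map (s.ι.app j).1.1 ≫ s.pt.φ.hom = _ := (s.ι.app j).2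
    have hc : F.map (c.ι.app j).1.1 ≫ c.pt.φ.hom = _ := (c.ι.app j).2
    dsimp at e₁ e₂ ⊢
    rw [← Category.assoc, ← F.map_comp, e₁, hs, ← Category.assoc, hc,
      Category.assoc, ← G.map_comp, e₂])
  fac s j := hom_ext (h₁.fac ((fst F G).mapCocone s) j) (h₂.fac ((snd F G).mapCocone s) j)
  uniq s m hm := hom_ext
    (h₁.uniq ((fst F G).mapCocone s) _ fun j ↦ congrArg (fst F G).map (hm j))
    (h₂.uniq ((snd F G).mapCocone s) _ fun j ↦ congrArg (snd F G).map (hm j))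

variable [PreservesColimit (Y ⋙ fst F G) F] [PreservesColimit (Y ⋙ snd F G) G]

/-- The cocone in the pseudopullback determined by colimits of the two projections. -/
noncomputable def coconeOfProjections {a : Cocone (Y ⋙ fst F G)} (ha : IsColimit a)
    {b : Cocone (Y ⋙ snd F G)} (hb : IsColimit b) : Cocone Y where
  pt :=
    { k := a.pt
      m := b.pt
      φ := (isColimitOfPreserves F ha).coconePointsIsoOfNatIso (isColimitOfPreserves G hb)
        (Functor.isoWhiskerLeft Y (squareIso F G)) }
  ι :=
    { app := fun j ↦ homMk (a.ι.app j) (b.ι.app j)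
        ((isColimitOfPreserves F ha).comp_coconePointsIsoOfNatIso_hom _ _ j)
      naturality := fun _ _ f ↦ hom_ext (a.ι.naturality f) (b.ι.naturality f) }

/-- The cocone determined by colimits of the two projections is colimiting. -/
noncomputable def isColimitCoconeOfProjections {a : Cocone (Y ⋙ fst F G)} (ha : IsColimit a)
    {b : Cocone (Y ⋙ snd F G)} (hb : IsColimit b) : IsColimit (coconeOfProjections ha hb) :=
  isColimitOfProjections (c := coconeOfProjections ha hb) ha hb

variable [HasColimit (Y ⋙ fst F G)] [HasColimit (Y ⋙ snd F G)]

lemma hasColimit : HasColimit Y :=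
  ⟨_, isColimitCoconeOfProjections (colimit.isColimit (Y ⋙ fst F G))
    (colimit.isColimit (Y ⋙ snd F G))⟩

lemma preservesColimit_fst : PreservesColimit Y (fst F G) :=
  preservesColimit_of_preserves_colimit_cocone (isColimitCoconeOfProjections
    (colimit.isColimit (Y ⋙ fst F G)) (colimit.isColimit (Y ⋙ snd F G)))
    (colimit.isColimit (Y ⋙ fst F G))

lemma preservesColimit_snd : PreservesColimit Y (snd F G) :=
  preservesColimit_of_preserves_colimit_cocone (isColimitCoconeOfProjections
    (colimit.isColimit (Y ⋙ fst F G)) (colimit.isColimit (Y ⋙ snd F G)))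
    (colimit.isColimit (Y ⋙ snd F G))

end Colimits

section Presentable

variable {μ : Cardinal.{v}} [Fact μ.IsRegular]

/-- An object of the pseudopullback is presentable if its components and their common image in
the base are. -/
lemma isCardinalPresentable_of_components [HasCardinalFilteredColimits K μ]
    [HasCardinalFilteredColimits N μ] [F.IsCardinalAccessible μ] [G.IsCardinalAccessible μ]
    (X : Pseudopullback F G) [IsCardinalPresentable X.k μ] [IsCardinalPresentable X.m μ]
    [IsCardinalPresentable (F.obj X.k) μ] : IsCardinalPresentable X μ where
  preservesColimitOfShape J _ _ := ⟨fun {Y} ↦ ⟨fun {c} hc ↦ by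
    have := HasCardinalFilteredColimits.hasColimitsOfShape (κ := μ) K J
    have := HasCardinalFilteredColimits.hasColimitsOfShape (κ := μ) N J
    have := F.preservesColimitsOfShape_of_isCardinalAccessible μ J
    have := G.preservesColimitsOfShape_of_isCardinalAccessible μ J
    have := preservesColimit_fst (Y := Y)
    have := preservesColimit_snd (Y := Y)
    have := isFiltered_of_isCardinalFiltered J μ
    have h₁ := isColimitOfPreserves (fst F G) hc
    have h₂ := isColimitOfPreserves (snd F G) hc
    have h₃ := isColimitOfPreserves G h₂
    refine ⟨Types.FilteredColimit.isColimitOf _ _ ?_ ?_⟩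
    · intro (f : X ⟶ c.pt)
      obtain ⟨i, u, hu⟩ := IsCardinalPresentable.exists_hom_of_isColimit μ h₁ f.1.1
      obtain ⟨j, v, hv⟩ := IsCardinalPresentable.exists_hom_of_isColimit μ h₂ f.1.2
      let l := IsFiltered.max i j
      let a : i ⟶ l := IsFiltered.leftToMax i j
      let b : j ⟶ l := IsFiltered.rightToMax i j
      let u' : X.k ⟶ (Y.obj l).k := u ≫ (fst F G).map (Y.map a)
      let v' : X.m ⟶ (Y.obj l).m := v ≫ (snd F G).map (Y.map b)
      have hu' : u' ≫ (fst F G).map (c.ι.app l) = f.1.1 := by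
        rw [Category.assoc, ← Functor.map_comp, c.w]
        exact hu
      have hv' : v' ≫ (snd F G).map (c.ι.app l) = f.1.2 := by
        rw [Category.assoc, ← Functor.map_comp, c.w]
        exact hv
      obtain ⟨n, e, he⟩ := IsCardinalPresentable.exists_eq_of_isColimit' μ h₃ (i := l)
        (F.map u' ≫ (Y.obj l).φ.hom) (X.φ.hom ≫ G.map v') (by
          have h := (c.ι.app l).2
          dsimp at hu' hv' ⊢
          rw [Category.assoc, ← h, ← Category.assoc, ← F.map_comp, hu', Category.assoc,
            ← G.map_comp, hv']
          exact f.2)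
      refine ⟨n, homMk (u' ≫ (fst F G).map (Y.map e)) (v' ≫ (snd F G).map (Y.map e)) ?_, ?_⟩
      · have h := (Y.map e).2
        dsimp at he ⊢
        rw [F.map_comp, Category.assoc, h, ← Category.assoc, he, Category.assoc,
          ← G.map_comp]
      · refine (hom_ext (X := X) ?_ ?_ : f = homMk _ _ _ ≫ c.ι.app n)
        · have := congrArg (u' ≫ (fst F G).map ·) (c.w e)
          rw [hu', Functor.map_comp, ← Category.assoc] at this
          exact this.symm
        · have := congrArg (v' ≫ (snd F G).map ·) (c.w e)
          rw [hv', Functor.map_comp, ← Category.assoc] at this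
          exact this.symm
    · intro i j (f : X ⟶ Y.obj i) (g : X ⟶ Y.obj j) (h : f ≫ c.ι.app i = g ≫ c.ι.app j)
      obtain ⟨k, a, b, e⟩ := IsCardinalPresentable.exists_eq_of_isColimit μ h₁ f.1.1 g.1.1
        (congrArg (fst F G).map h)
      obtain ⟨l, a', b', e'⟩ := IsCardinalPresentable.exists_eq_of_isColimit μ h₂
        (f ≫ Y.map a).1.2 (g ≫ Y.map b).1.2 (by
          refine congrArg (snd F G).map (?_ : (f ≫ Y.map a) ≫ c.ι.app k =
            (g ≫ Y.map b) ≫ c.ι.app k)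
          rw [Category.assoc, Category.assoc, c.w, c.w, h])
      let n := IsFiltered.coeq a' b'
      let t := IsFiltered.coeqHom a' b'
      refine ⟨n, a ≫ a' ≫ t, b ≫ a' ≫ t, ?_⟩
      refine (hom_ext (X := X) ?_ ?_ : f ≫ Y.map (a ≫ a' ≫ t) = g ≫ Y.map (b ≫ a' ≫ t))
      · have := congrArg (· ≫ (Y ⋙ fst F G).map (a' ≫ t)) e
        rw [Category.assoc, Category.assoc, ← Functor.map_comp, ← Functor.map_comp] at this
        exact this
      · have h' := congrArg (· ≫ (Y ⋙ snd F G).map t) e'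
        rw [Category.assoc, Category.assoc, ← Functor.map_comp, ← Functor.map_comp,
          ← IsFiltered.coeq_condition a' b'] at h'
        have hf : f ≫ Y.map (a ≫ a' ≫ t) = (f ≫ Y.map a) ≫ Y.map (a' ≫ t) := by simp
        have hg : g ≫ Y.map (b ≫ a' ≫ t) = (g ≫ Y.map b) ≫ Y.map (a' ≫ t) := by simp
        rw [hf, hg]
        exact h'⟩⟩

end Presentable

open CategoryTheory.Interleaving

section Chains

variable {O I : Type v} [LinearOrder O] [NoMaxOrder O] [PartialOrder I]
  {A : I ⥤ K} {B : I ⥤ N} (D : Interleaving (A ⋙ F) (B ⋙ G))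
  [HasColimitsOfShape O K] [HasColimitsOfShape O N]
  [PreservesColimitsOfShape O F] [PreservesColimitsOfShape O G]

variable (O) in
/-- The diagram in the pseudopullback given by the colimits along adapted chains. -/
noncomputable def chainDiagram : AdaptedChain O D ⥤ Pseudopullback F G where
  obj t :=
    { k := (chainFunctor (isMonotoneFamily_adaptedChain O D) A).obj t
      m := (chainFunctor (isMonotoneFamily_adaptedChain O D) B).obj t
      φ := chainIso t.2 (isColimitOfPreserves F (colimit.isColimit (t.1 ⋙ A)))
        (isColimitOfPreserves G (colimit.isColimit (t.1 ⋙ B))) }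
  map {s t} f := homMk ((chainFunctor (isMonotoneFamily_adaptedChain O D) A).map f)
    ((chainFunctor (isMonotoneFamily_adaptedChain O D) B).map f) (by
      let hs := isColimitOfPreserves F (colimit.isColimit (s.1 ⋙ A))
      let hs' := isColimitOfPreserves G (colimit.isColimit (s.1 ⋙ B))
      let ht := isColimitOfPreserves F (colimit.isColimit (t.1 ⋙ A))
      have h' := isMonotoneFamily_adaptedChain O D (leOfHom f)
      exact (congrArg (· ≫ _) (map_chainMap _ (colimit.cocone _) h' F hs)).trans
        ((chainMap_comp_chainHom s.2 t.2 hs ht hs' (G.mapCocone (colimit.cocone (t.1 ⋙ B)))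
          (leOfHom f) h').trans
          (congrArg (_ ≫ ·) (map_chainMap _ (colimit.cocone _) h' G hs').symm)))
  map_id t := hom_ext
    ((chainFunctor (isMonotoneFamily_adaptedChain O D) A).map_id t)
    ((chainFunctor (isMonotoneFamily_adaptedChain O D) B).map_id t)
  map_comp f g := hom_ext
    ((chainFunctor (isMonotoneFamily_adaptedChain O D) A).map_comp f g)
    ((chainFunctor (isMonotoneFamily_adaptedChain O D) B).map_comp f g)

variable (O) in
/-- The cocone over the diagram of colimits along adapted chains. -/
noncomputable def chainDiagramCocone (a : Cocone A) (b : Cocone B)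
    (φ : F.obj a.pt ≅ G.obj b.pt)
    (h : ∀ x, D.f x ≫ G.map (b.ι.app (D.next x)) = F.map (a.ι.app x) ≫ φ.hom) :
    Cocone (chainDiagram O D) where
  pt := ⟨a.pt, b.pt, φ⟩
  ι :=
    { app := fun t ↦ homMk
        ((chainFunctorCocone (isMonotoneFamily_adaptedChain O D) a).ι.app t)
        ((chainFunctorCocone (isMonotoneFamily_adaptedChain O D) b).ι.app t) (by
          let ht := isColimitOfPreserves F (colimit.isColimit (t.1 ⋙ A))
          let ht' := isColimitOfPreserves G (colimit.isColimit (t.1 ⋙ B))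
          exact (congrArg (· ≫ _) (map_chainDesc _ a F ht)).trans
            ((chainDesc_comp t.2 ht ht' (F.mapCocone a) (G.mapCocone b) φ.hom h).trans
              (congrArg (_ ≫ ·) (map_chainDesc _ b G ht').symm)))
      naturality := fun _ _ f ↦ hom_ext
        ((chainFunctorCocone (isMonotoneFamily_adaptedChain O D) a).ι.naturality f)
        ((chainFunctorCocone (isMonotoneFamily_adaptedChain O D) b).ι.naturality f) }

lemma nonempty_isColimit_chainDiagramCocone [IsDirectedOrder (AdaptedChain O D)]
    [PreservesColimitsOfShape (AdaptedChain O D) F]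
    (hD : ∀ x, ∃ t : AdaptedChain O D, IsBelowChain t.1 x)
    {a : Cocone A} (ha : IsColimit a) {b : Cocone B} (hb : IsColimit b)
    (φ : F.obj a.pt ≅ G.obj b.pt)
    (h : ∀ x, D.f x ≫ G.map (b.ι.app (D.next x)) = F.map (a.ι.app x) ≫ φ.hom) :
    Nonempty (IsColimit (chainDiagramCocone O D a b φ h)) := by
  obtain ⟨h₁⟩ := nonempty_isColimit_chainFunctorCocone (isMonotoneFamily_adaptedChain O D) ha hD
  obtain ⟨h₂⟩ := nonempty_isColimit_chainFunctorCocone (isMonotoneFamily_adaptedChain O D) hb hD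
  exact ⟨isColimitOfProjections (c := chainDiagramCocone O D a b φ h) h₁ h₂⟩

end Chains

end Pseudopullback

open CategoryTheory.Interleaving

lemma isCardinalFiltered_iff (J : Type v) [SmallCategory J] (μ : Cardinal.{v})
    [Fact μ.IsRegular] : IsCardinalFiltered J μ ↔ CategoryTheory.IsCardinalFiltered J μ := by
  refine ⟨fun h ↦ ⟨fun {A _} F hA ↦ h A ?_ F⟩, fun h A _ hA F ↦ h.nonempty_cocone F ?_⟩
  · rwa [← hasCardinalLT_iff_cardinal_mk_lt]
  · rwa [hasCardinalLT_iff_cardinal_mk_lt]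

section Translation

variable {C : Type u} [Category.{v} C] (μ : Cardinal.{v}) [Fact μ.IsRegular]

lemma isPresentable_iff (X : C) :
    IsPresentable μ X ↔ IsCardinalPresentable X μ := by
  refine ⟨fun h ↦ ⟨fun J _ hJ ↦ (h J ((isCardinalFiltered_iff J μ).2 hJ)).some⟩,
    fun h J _ hJ ↦ ⟨?_⟩⟩
  have := (isCardinalFiltered_iff J μ).1 hJ
  exact h.preservesColimitOfShape J

lemma hasCardinalFilteredColimits_iff :
    HasCardinalFilteredColimits C μ ↔
      ∀ (J : Type v) [SmallCategory J], IsCardinalFiltered J μ → HasColimitsOfShape J C := by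
  refine ⟨fun h J _ hJ ↦ ?_, fun h ↦ ⟨fun J _ hJ ↦ h J ((isCardinalFiltered_iff J μ).2 hJ)⟩⟩
  have := (isCardinalFiltered_iff J μ).1 hJ
  exact h.hasColimitsOfShape J

lemma isAccessibleCategory_iff :
    IsAccessibleCategory C μ ↔ IsCardinalAccessibleCategory C μ := by
  constructor
  · rintro ⟨h, ι, X, hX, hC⟩
    have := (hasCardinalFilteredColimits_iff μ).2 h
    let P : ObjectProperty C := (· ∈ Set.range X)
    have : ObjectProperty.Small.{v} P := inferInstanceAs (Small.{v} (Set.range X))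
    have hP : P.IsCardinalFilteredGenerator μ :=
      { le_isCardinalPresentable := by
          rintro _ ⟨i, rfl⟩
          exact (isPresentable_iff μ _).1 (hX i)
        exists_colimitsOfShape := fun Y ↦ by
          obtain ⟨p⟩ := hC Y
          let := p.instJ
          refine ⟨p.J, inferInstance, (isCardinalFiltered_iff p.J μ).1 p.filtered, ⟨?_⟩⟩
          exact ObjectProperty.ColimitOfShape.ofIso
            { diag := p.F, ι := p.c.ι, isColimit := p.isColimit, prop_diag_obj := p.mem } p.iso }
    have := hP.hasCardinalFilteredGenerator
    exact {}
  · intro h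
    refine ⟨(hasCardinalFilteredColimits_iff μ).1 inferInstance, ?_⟩
    obtain ⟨P, _, hP⟩ := HasCardinalFilteredGenerator.exists_small_generator C μ
    refine ⟨Shrink.{v} (Subtype P), fun i ↦ ((equivShrink _).symm i).1, fun i ↦ ?_, fun Y ↦ ?_⟩
    · exact (isPresentable_iff μ _).2 (hP.le_isCardinalPresentable _ ((equivShrink _).symm i).2)
    · obtain ⟨J, _, hJ, ⟨p⟩⟩ := hP.exists_colimitsOfShape Y
      exact ⟨{ J := J
               filtered := (isCardinalFiltered_iff J μ).2 hJ
               F := p.diag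
               mem := fun j ↦ ⟨equivShrink _ ⟨_, p.prop_diag_obj j⟩, by simp⟩
               c := Cocone.mk _ p.ι
               isColimit := p.isColimit
               iso := Iso.refl _ }⟩

end Translation

namespace Pseudopullback

variable {K : Type u} [Category.{v} K] {L : Type u} [Category.{v} L]
  {N : Type u} [Category.{v} N] {F : K ⥤ L} {G : N ⥤ L}

section

variable (F G) (κ : Cardinal.{v}) [Fact κ.IsRegular] [HasCardinalFilteredColimits K κ]
  [HasCardinalFilteredColimits N κ] [F.IsCardinalAccessible κ] [G.IsCardinalAccessible κ]

lemma hasCardinalFilteredColimits : HasCardinalFilteredColimits (Pseudopullback F G) κ where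
  hasColimitsOfShape J _ _ := by
    have := HasCardinalFilteredColimits.hasColimitsOfShape (κ := κ) K J
    have := HasCardinalFilteredColimits.hasColimitsOfShape (κ := κ) N J
    have := F.preservesColimitsOfShape_of_isCardinalAccessible κ J
    have := G.preservesColimitsOfShape_of_isCardinalAccessible κ J
    exact ⟨fun Y ↦ hasColimit⟩

end

variable (F G) in
/-- The objects of the pseudopullback both of whose components are presentable. -/
def presentableComponents (μ : Cardinal.{v}) [Fact μ.IsRegular] :
    ObjectProperty (Pseudopullback F G) :=
  fun X ↦ IsCardinalPresentable X.k μ ∧ IsCardinalPresentable X.m μ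

variable {μ : Cardinal.{v}} [Fact μ.IsRegular]

instance [HasCardinalFilteredGenerator K μ] [HasCardinalFilteredGenerator N μ] :
    ObjectProperty.EssentiallySmall.{v} (presentableComponents F G μ) where
  exists_small_le' := by
    obtain ⟨P, _, -, hP⟩ :=
      ObjectProperty.EssentiallySmall.exists_small_le.{v} (isCardinalPresentable K μ)
    obtain ⟨Q, _, -, hQ⟩ :=
      ObjectProperty.EssentiallySmall.exists_small_le.{v} (isCardinalPresentable N μ)
    refine ⟨fun X ↦ P X.k ∧ Q X.m, ?_, fun X hX ↦ ?_⟩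
    · let f (x : Σ p : Subtype P × Subtype Q, F.obj p.1.1 ≅ G.obj p.2.1) :
          Subtype fun X : Pseudopullback F G ↦ P X.k ∧ Q X.m :=
        ⟨⟨x.1.1.1, x.1.2.1, x.2⟩, x.1.1.2, x.1.2.2⟩
      exact small_of_surjective (f := f) fun X ↦ ⟨⟨(⟨_, X.2.1⟩, ⟨_, X.2.2⟩), X.1.φ⟩, rfl⟩
    · obtain ⟨k, hk, ⟨e⟩⟩ := hP _ hX.1
      obtain ⟨m, hm, ⟨e'⟩⟩ := hQ _ hX.2
      exact ⟨⟨k, m, F.mapIso e.symm ≪≫ X.φ ≪≫ G.mapIso e'⟩, ⟨hk, hm⟩,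
        ⟨isoMk e e' (by simp [← Functor.map_comp_assoc])⟩⟩

variable {κ : Cardinal.{v}} [Fact κ.IsRegular]

lemma isCardinalFilteredGenerator_presentableComponents (h : κ < μ)
    [HasCardinalFilteredGenerator K μ] [HasCardinalFilteredGenerator N μ]
    [HasCardinalFilteredColimits K κ] [HasCardinalFilteredColimits N κ]
    [F.IsCardinalAccessible κ] [G.IsCardinalAccessible κ]
    (hF : ∀ X : K, IsCardinalPresentable X μ → IsCardinalPresentable (F.obj X) μ)
    (hG : ∀ X : N, IsCardinalPresentable X μ → IsCardinalPresentable (G.obj X) μ) :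
    (presentableComponents F G μ).IsCardinalFilteredGenerator μ where
  le_isCardinalPresentable X hX := by
    have : HasCardinalFilteredColimits K μ := .of_le (κ := κ) h.le
    have : HasCardinalFilteredColimits N μ := .of_le (κ := κ) h.le
    have := F.isCardinalAccessible_of_le h.le
    have := G.isCardinalAccessible_of_le h.le
    have := hX.1
    have := hX.2
    have := hF _ hX.1
    exact isCardinalPresentable_of_components X
  exists_colimitsOfShape X := by
    obtain ⟨P, _, hP⟩ := HasCardinalFilteredGenerator.exists_generator K μ
    obtain ⟨Q, _, hQ⟩ := HasCardinalFilteredGenerator.exists_generator N μ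
    obtain ⟨J₁, _, _, ⟨p⟩⟩ := hP.exists_colimitsOfShape X.k
    obtain ⟨J₂, _, _, ⟨q⟩⟩ := hQ.exists_colimitsOfShape X.m
    have := isFiltered_of_isCardinalFiltered J₁ μ
    have := isFiltered_of_isCardinalFiltered J₂ μ
    obtain ⟨I, _, _, E, _⟩ := CategoryTheory.IsCardinalFiltered.exists_cardinal_directed (J₁ × J₂) μ
    let p' := p.reindex (E ⋙ CategoryTheory.Prod.fst J₁ J₂)
    let q' := q.reindex (E ⋙ CategoryTheory.Prod.snd J₁ J₂)
    have hp (x) : IsCardinalPresentable (p'.diag.obj x) μ :=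
      hP.le_isCardinalPresentable _ (p'.prop_diag_obj x)
    have hq (x) : IsCardinalPresentable (q'.diag.obj x) μ :=
      hQ.le_isCardinalPresentable _ (q'.prop_diag_obj x)
    have := F.isCardinalAccessible_of_le h.le
    have := G.isCardinalAccessible_of_le h.le
    have := F.preservesColimitsOfShape_of_isCardinalAccessible μ I
    have := G.preservesColimitsOfShape_of_isCardinalAccessible μ I
    obtain ⟨D, hD⟩ := exists_interleaving (μ := μ) (A := p'.diag ⋙ F) (B := q'.diag ⋙ G)
      (isColimitOfPreserves F p'.isColimit) (isColimitOfPreserves G q'.isColimit) X.φ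
      (fun x ↦ hF _ (hp x)) (fun x ↦ hG _ (hq x))
    let O := κ.ord.ToType
    have hO : HasCardinalLT O μ := by
      rwa [hasCardinalLT_iff_cardinal_mk_lt, Cardinal.mk_ord_toType]
    have : NoMaxOrder O := Cardinal.noMaxOrder (Cardinal.IsRegular.aleph0_le Fact.out)
    have : Nonempty O := CategoryTheory.IsCardinalFiltered.nonempty O κ
    have := HasCardinalFilteredColimits.hasColimitsOfShape (κ := κ) K O
    have := HasCardinalFilteredColimits.hasColimitsOfShape (κ := κ) N O
    have := F.preservesColimitsOfShape_of_isCardinalAccessible κ O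
    have := G.preservesColimitsOfShape_of_isCardinalAccessible κ O
    have hT := D.isCardinalFiltered_adaptedChain hO
    have := isFiltered_of_isCardinalFiltered (AdaptedChain O D) μ
    have := IsFiltered.isDirectedOrder (AdaptedChain O D)
    have := F.preservesColimitsOfShape_of_isCardinalAccessible μ (AdaptedChain O D)
    obtain ⟨hc⟩ := nonempty_isColimit_chainDiagramCocone (O := O) D
      (D.exists_adaptedChain_isBelowChain hO) p'.isColimit q'.isColimit X.φ hD
    refine ⟨AdaptedChain O D, inferInstance, hT,
      ⟨{ diag := chainDiagram O D
         ι := (chainDiagramCocone O D p'.cocone q'.cocone X.φ hD).ι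
         isColimit := hc
         prop_diag_obj := fun t ↦ ⟨?_, ?_⟩ }⟩⟩
    · have (a : O) : IsCardinalPresentable ((t.1 ⋙ p'.diag).obj a) μ := hp _
      exact isCardinalPresentable_of_isColimit _ (colimit.isColimit (t.1 ⋙ p'.diag)) μ
        (hasCardinalLT_arrow_of_preorder hO)
    · have (a : O) : IsCardinalPresentable ((t.1 ⋙ q'.diag).obj a) μ := hq _
      exact isCardinalPresentable_of_isColimit _ (colimit.isColimit (t.1 ⋙ q'.diag)) μ
        (hasCardinalLT_arrow_of_preorder hO)

end Pseudopullback

/-- Pseudopullback Theorem. Let `λ` be a regular cardinal and `K`, `L`, `N`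
`λ`-accessible categories which admit `κ`-filtered colimits for some regular `κ < λ`. Let
`F : K ⥤ L` and `G : N ⥤ L` preserve `κ`-filtered colimits and `λ`-presentable objects.
Then the pseudopullback of `F` and `G` is `λ`-accessible and has `κ`-filtered colimits. -/
theorem statement7 {K L N : Type u} [Category.{v} K] [Category.{v} L] [Category.{v} N]
    (κ lam : Cardinal.{v}) (hκ : κ.IsRegular) (hlam : lam.IsRegular) (hlt : κ < lam)
    (hK : IsAccessibleCategory K lam) (hL : IsAccessibleCategory L lam)
    (hN : IsAccessibleCategory N lam)
    (hKκ : ∀ (J : Type v) [SmallCategory J], IsCardinalFiltered J κ → HasColimitsOfShape J K)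
    (hLκ : ∀ (J : Type v) [SmallCategory J], IsCardinalFiltered J κ → HasColimitsOfShape J L)
    (hNκ : ∀ (J : Type v) [SmallCategory J], IsCardinalFiltered J κ → HasColimitsOfShape J N)
    (F : K ⥤ L) (G : N ⥤ L)
    (hFc : ∀ (J : Type v) [SmallCategory J], IsCardinalFiltered J κ →
      Nonempty (PreservesColimitsOfShape J F))
    (hGc : ∀ (J : Type v) [SmallCategory J], IsCardinalFiltered J κ →
      Nonempty (PreservesColimitsOfShape J G))
    (hFp : ∀ X : K, IsPresentable lam X → IsPresentable lam (F.obj X))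
    (hGp : ∀ X : N, IsPresentable lam X → IsPresentable lam (G.obj X)) :
    IsAccessibleCategory (Pseudopullback F G) lam ∧
    ∀ (J : Type v) [SmallCategory J], IsCardinalFiltered J κ →
      HasColimitsOfShape J (Pseudopullback F G) := by
  have : Fact κ.IsRegular := ⟨hκ⟩
  have : Fact lam.IsRegular := ⟨hlam⟩
  have := (isAccessibleCategory_iff lam).1 hK
  have := (isAccessibleCategory_iff lam).1 hN
  have := (hasCardinalFilteredColimits_iff κ).2 hKκ
  have := (hasCardinalFilteredColimits_iff κ).2 hNκ
  have : F.IsCardinalAccessible κ :=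
    ⟨fun J _ hJ ↦ (hFc J ((isCardinalFiltered_iff J κ).2 hJ)).some⟩
  have : G.IsCardinalAccessible κ :=
    ⟨fun J _ hJ ↦ (hGc J ((isCardinalFiltered_iff J κ).2 hJ)).some⟩
  have := (Pseudopullback.isCardinalFilteredGenerator_presentableComponents hlt
    (fun X hX ↦ (isPresentable_iff lam _).1 (hFp X ((isPresentable_iff lam X).2 hX)))
    (fun X hX ↦ (isPresentable_iff lam _).1
      (hGp X ((isPresentable_iff lam X).2 hX)))).hasCardinalFilteredGenerator
  have hP := Pseudopullback.hasCardinalFilteredColimits F G κ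
  have := HasCardinalFilteredColimits.of_le (C := Pseudopullback F G) hlt.le
  exact ⟨(isAccessibleCategory_iff lam).2 {}, (hasCardinalFilteredColimits_iff κ).1 hP⟩

end PaperAcc
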